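/- Let μ be a quasi-stationary Markov measure on K_N associated to (λ, T). Then μ is ergodic with respect to the one-sided shift σ, in the sense that for every Borel set A ⊆ K_N with σ^{-1}(A) = A, either μ(A) = 0 or μ(K_N \ A) = 0. -/

import Mathlib

open MeasureTheory Filter Finset

/-- `IsMarkov μ l T` means that `μ` is the Markov measure on `K_N = ℕ → Fin N`
associated to the probability vector `l` and the sequence of transition matrices `T`
(with `T n` playing the role of `T^(n+1)` of the paper, and words indexed from `0`):
for every cylinder set determined by the first `n + 1` letters,
`μ(C(w₀ … w_n)) = l_{w₀} T^(1)_{w₀,w₁} ⋯ T^(n)_{w_{n-1},w_n}`. -/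
def IsMarkov {N : ℕ} (μ : Measure (ℕ → Fin N)) (l : Fin N → ℝ)
    (T : ℕ → Matrix (Fin N) (Fin N) ℝ) : Prop :=
  ∀ (n : ℕ) (w : ℕ → Fin N),
    μ {x | ∀ k ≤ n, x k = w k} =
      ENNReal.ofReal (l (w 0) * ∏ k ∈ Finset.range n, T k (w k) (w (k + 1)))

/-- A positive sequence whose consecutive ratios are summably close to `1` is bounded below by a
positive constant. -/
theorem exists_pos_le_of_summable_ratio {a : ℕ → ℝ} (ha : ∀ n, 0 < a n)
    (hs : Summable fun n => |a n / a (n + 1) - 1|) : ∃ δ > 0, ∀ n, δ ≤ a n := by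
  refine ⟨a 0 * Real.exp (-∑' n, |a n / a (n + 1) - 1|), by have := ha 0; positivity, fun n => ?_⟩
  have key : ∀ n, a 0 ≤ a n * Real.exp (∑ k ∈ range n, |a k / a (k + 1) - 1|) := by
    intro n
    induction n with
    | zero => simp
    | succ n ih =>
      have h1 : a n / a (n + 1) ≤ Real.exp |a n / a (n + 1) - 1| := by
        linarith [le_abs_self (a n / a (n + 1) - 1), Real.add_one_le_exp |a n / a (n + 1) - 1|]
      rw [div_le_iff₀ (ha _)] at h1
      rw [sum_range_succ, Real.exp_add]
      refine ih.trans ((mul_le_mul_of_nonneg_right h1 (Real.exp_pos _).le).trans_eq (by ring))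
  have h2 : Real.exp (∑ k ∈ range n, |a k / a (k + 1) - 1|)
      ≤ Real.exp (∑' n, |a n / a (n + 1) - 1|) :=
    Real.exp_le_exp.2 (hs.sum_le_tsum _ fun _ _ => abs_nonneg _)
  rw [Real.exp_neg, ← div_eq_mul_inv, div_le_iff₀ (Real.exp_pos _)]
  exact (key n).trans (mul_le_mul_of_nonneg_left h2 (ha n).le)

/-- Transition matrices of a quasi-stationary Markov measure are uniformly bounded below. -/
theorem exists_pos_le_of_quasiStationary {N : ℕ} {T : ℕ → Matrix (Fin N) (Fin N) ℝ}
    (hpos : ∀ n i j, 0 < T n i j)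
    (hqs : ∀ x : ℕ → Fin N,
      Summable fun n => |T n (x n) (x (n + 1)) / T (n + 1) (x n) (x (n + 1)) - 1|) :
    ∃ δ > 0, ∀ n i j, δ ≤ T n i j := by
  have hsum : ∀ i j, Summable fun n => |T n i j / T (n + 1) i j - 1| := by
    intro i j
    refine Summable.of_nonneg_of_le (fun _ => abs_nonneg _) (fun n => ?_)
      ((hqs fun n => if Even n then i else j).add (hqs fun n => if Even n then j else i))
    by_cases hn : Even n
    · simp [hn, Nat.even_add_one]
    · simp [hn, Nat.even_add_one]
  choose δ hδ hle using fun p : Fin N × Fin N =>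
    exists_pos_le_of_summable_ratio (fun n => hpos n p.1 p.2) (hsum p.1 p.2)
  rcases isEmpty_or_nonempty (Fin N × Fin N) with he | he
  · exact ⟨1, one_pos, fun n i j => (he.false (i, j)).elim⟩
  · obtain ⟨p, hp⟩ := Finite.exists_min δ
    exact ⟨δ p, hδ p, fun n i j => (hp (i, j)).trans (hle (i, j) n)⟩

/-- The restriction of an infinite word to its first `n + 1` letters. -/
def prefixMap (N n : ℕ) (x : ℕ → Fin N) : Fin (n + 1) → Fin N := fun k => x k

theorem measurable_prefixMap (N n : ℕ) : Measurable (prefixMap N n) :=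
  measurable_pi_lambda _ fun _ => measurable_pi_apply _

/-- The infinite word extending a finite word `u` by its last letter. -/
def extendWord {N n : ℕ} (u : Fin (n + 1) → Fin N) (k : ℕ) : Fin N :=
  u ⟨min k n, by omega⟩

theorem prefixMap_preimage_singleton {N n : ℕ} (u : Fin (n + 1) → Fin N) :
    prefixMap N n ⁻¹' {u} = {x | ∀ k ≤ n, x k = extendWord u k} := by
  ext x
  simp only [Set.mem_preimage, Set.mem_singleton_iff, funext_iff, prefixMap, Set.mem_ofPred_eq,
    extendWord]
  constructor
  · intro h k hk
    simpa [hk] using h ⟨k, by omega⟩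
  · intro h k
    have hk : (k : ℕ) ≤ n := by omega
    simpa [hk] using h k hk

theorem measurableSet_word {N : ℕ} (n : ℕ) (w : ℕ → Fin N) :
    MeasurableSet {x : ℕ → Fin N | ∀ k ≤ n, x k = w k} := by
  have : {x : ℕ → Fin N | ∀ k ≤ n, x k = w k} = ⋂ k, ⋂ _ : k ≤ n, (fun x => x k) ⁻¹' {w k} := by
    ext; simp
  rw [this]
  exact .iInter fun k => .iInter fun _ => measurable_pi_apply k (MeasurableSet.singleton _)

theorem sum_measure_inter_word {N : ℕ} (μ : Measure (ℕ → Fin N)) (n : ℕ)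
    (B : Set (ℕ → Fin N)) :
    μ B = ∑ u : Fin (n + 1) → Fin N, μ ({x | ∀ k ≤ n, x k = extendWord u k} ∩ B) := by
  have h := sum_measure_preimage_singleton (μ := μ.restrict B) (f := prefixMap N n) univ
    fun u _ => measurable_prefixMap N n (MeasurableSet.singleton u)
  simp only [coe_univ, Set.preimage_univ, Measure.restrict_apply_univ] at h
  rw [← h]
  refine sum_congr rfl fun u _ => ?_
  rw [Measure.restrict_apply (measurable_prefixMap N n (MeasurableSet.singleton u)),
    prefixMap_preimage_singleton]

/-- Domination of finite measures on the space of infinite words may be checked on cylinders. -/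
theorem measure_le_of_word_le {N : ℕ} {ν₁ ν₂ : Measure (ℕ → Fin N)} [IsFiniteMeasure ν₂]
    (h : ∀ (n : ℕ) (w : ℕ → Fin N),
      ν₁ {x | ∀ k ≤ n, x k = w k} ≤ ν₂ {x | ∀ k ≤ n, x k = w k}) : ν₁ ≤ ν₂ := by
  have hopen : ∀ U : Set (ℕ → Fin N), IsOpen U → ν₁ U ≤ ν₂ U := by
    classical
    intro U hU
    let V : ℕ → Set (ℕ → Fin N) := fun n => {x | {y | ∀ k ≤ n, y k = x k} ⊆ U}
    have hmono : Monotone V := fun m n hmn x hx y hy => hx fun k hk => hy k (hk.trans hmn)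
    have hUV : U = ⋃ n, V n := by
      ext x
      simp only [Set.mem_iUnion]
      constructor
      · intro hx
        obtain ⟨s, ⟨y, n, rfl⟩, hxs, hs⟩ :=
          (PiNat.isTopologicalBasis_cylinders (fun _ : ℕ => Fin N)).exists_subset_of_mem_open hx hU
        refine ⟨n, fun z hz => hs fun k hk => (hz k hk.le).trans (hxs k hk)⟩
      · rintro ⟨n, hn⟩
        exact hn fun _ _ => rfl
    have hV : ∀ n, ν₁ (V n) ≤ ν₂ (V n) := by
      intro n
      have hpre : V n = prefixMap N n ⁻¹'
          ((univ.filter fun u : Fin (n + 1) → Fin N =>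
            {y : ℕ → Fin N | ∀ k ≤ n, y k = extendWord u k} ⊆ U : Finset _) : Set (Fin (n + 1) → Fin N)) := by
        ext x
        have hx : ∀ k ≤ n, x k = extendWord (prefixMap N n x) k := by
          intro k hk
          simp [extendWord, prefixMap, hk]
        have : {y : ℕ → Fin N | ∀ k ≤ n, y k = x k} =
            {y | ∀ k ≤ n, y k = extendWord (prefixMap N n x) k} := by
          ext y
          exact forall₂_congr fun k hk => by rw [hx k hk]
        simp [V, this]
      have hm : ∀ u : Fin (n + 1) → Fin N, MeasurableSet (prefixMap N n ⁻¹' {u}) :=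
        fun u => measurable_prefixMap N n (MeasurableSet.singleton u)
      rw [hpre, ← sum_measure_preimage_singleton _ fun u _ => hm u,
        ← sum_measure_preimage_singleton _ fun u _ => hm u]
      refine sum_le_sum fun u _ => ?_
      rw [prefixMap_preimage_singleton]
      exact h n _
    rw [hUV, hmono.measure_iUnion, hmono.measure_iUnion]
    exact iSup_mono hV
  refine Measure.le_iff.2 fun E _ => ?_
  rw [E.measure_eq_iInf_isOpen ν₂]
  exact le_iInf₂ fun U hEU => le_iInf fun hU => (measure_mono hEU).trans (hopen U hU)

/-- The iterated shift on infinite words. -/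
def shiftBy (N n : ℕ) (x : ℕ → Fin N) (k : ℕ) : Fin N := x (n + k)

theorem measurable_shiftBy (N n : ℕ) : Measurable (shiftBy N n) :=
  measurable_pi_lambda _ fun _ => measurable_pi_apply _

theorem shiftBy_preimage {N : ℕ} {A : Set (ℕ → Fin N)}
    (hA : (fun (x : ℕ → Fin N) (n : ℕ) => x (n + 1)) ⁻¹' A = A) (n : ℕ) :
    shiftBy N n ⁻¹' A = A := by
  induction n with
  | zero =>
    have : shiftBy N 0 = id := by
      funext x k
      simp [shiftBy]
    rw [this, Set.preimage_id]
  | succ n ih =>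
    nth_rewrite 2 [← ih]
    nth_rewrite 2 [← hA]
    ext x
    have : shiftBy N (n + 1) x = fun k => shiftBy N n x (k + 1) := by
      funext k
      simp only [shiftBy]
      congr 1
      omega
    simp only [Set.mem_preimage, this]

/-- The Markov property on cylinders. -/
theorem IsMarkov.measure_word_inter_shiftBy {N : ℕ} {μ : Measure (ℕ → Fin N)} {l : Fin N → ℝ}
    {T : ℕ → Matrix (Fin N) (Fin N) ℝ} (hμ : IsMarkov μ l T) (hl : ∀ i, 0 < l i)
    (hpos : ∀ n i j, 0 < T n i j) (n m : ℕ) (w v : ℕ → Fin N) :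
    μ ({x | ∀ k ≤ n, x k = w k} ∩ shiftBy N (n + 1) ⁻¹' {x | ∀ k ≤ m, x k = v k}) =
      μ {x | ∀ k ≤ n, x k = w k} * (ENNReal.ofReal (T n (w n) (v 0)) *
        ENNReal.ofReal (∏ k ∈ range m, T (n + 1 + k) (v k) (v (k + 1)))) := by
  let c : ℕ → Fin N := fun k => if k ≤ n then w k else v (k - (n + 1))
  have hc : ∀ k ≤ n, c k = w k := fun k hk => if_pos hk
  have hc' : ∀ k, c (n + 1 + k) = v k := by
    intro k
    simp only [c]
    rw [if_neg (by omega)]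
    congr 1
    omega
  have hset : {x : ℕ → Fin N | ∀ k ≤ n, x k = w k} ∩
      shiftBy N (n + 1) ⁻¹' {x | ∀ k ≤ m, x k = v k} = {x | ∀ k ≤ n + 1 + m, x k = c k} := by
    ext x
    simp only [Set.mem_inter_iff, Set.mem_ofPred_eq, Set.mem_preimage, shiftBy]
    constructor
    · rintro ⟨h1, h2⟩ k hk
      rcases le_or_gt k n with hkn | hkn
      · rw [hc k hkn, h1 k hkn]
      · obtain ⟨j, rfl⟩ := Nat.exists_eq_add_of_le (Nat.succ_le_of_lt hkn)
        rw [hc', h2 j (by omega)]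
    · intro h
      exact ⟨fun k hk => by rw [h k (by omega), hc k hk],
        fun k hk => by rw [h _ (by omega), hc']⟩
  have hprod : ∏ k ∈ range n, T k (c k) (c (k + 1)) = ∏ k ∈ range n, T k (w k) (w (k + 1)) := by
    refine prod_congr rfl fun k hk => ?_
    have := mem_range.1 hk
    rw [hc k (by omega), hc (k + 1) (by omega)]
  have hprod' : ∏ k ∈ range m, T (n + 1 + k) (c (n + 1 + k)) (c (n + 1 + k + 1)) =
      ∏ k ∈ range m, T (n + 1 + k) (v k) (v (k + 1)) :=
    prod_congr rfl fun k _ => by rw [hc', add_assoc (n + 1), hc']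
  rw [hset, hμ, hμ, prod_range_add, prod_range_succ, hprod, hprod', hc 0 (by omega),
    hc n le_rfl, show c (n + 1) = v 0 from hc' 0, ← ENNReal.ofReal_mul (hpos _ _ _).le,
    ← ENNReal.ofReal_mul (mul_nonneg (hl _).le (prod_nonneg fun _ _ => (hpos _ _ _).le))]
  congr 1
  ring

/-- If the transition probabilities are at least `δ`, then the future after time `n` has, given any
initial word of length `n + 1`, conditional law at least `δ` times its unconditional law. -/
theorem IsMarkov.mul_measure_shiftBy_le {N : ℕ} {μ : Measure (ℕ → Fin N)}
    [IsProbabilityMeasure μ] {l : Fin N → ℝ} {T : ℕ → Matrix (Fin N) (Fin N) ℝ}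
    (hμ : IsMarkov μ l T) (hl : ∀ i, 0 < l i) (hpos : ∀ n i j, 0 < T n i j)
    (hstoch : ∀ n i, ∑ j, T n i j = 1) {δ : ℝ} (hδ : ∀ n i j, δ ≤ T n i j)
    (n : ℕ) (w : ℕ → Fin N) {B : Set (ℕ → Fin N)} (hB : MeasurableSet B) :
    ENNReal.ofReal δ * μ {x | ∀ k ≤ n, x k = w k} * μ (shiftBy N (n + 1) ⁻¹' B) ≤
      μ ({x | ∀ k ≤ n, x k = w k} ∩ shiftBy N (n + 1) ⁻¹' B) := by
  have hT : ∀ n i j, T n i j ≤ 1 := fun n i j =>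
    (single_le_sum (fun j _ => (hpos n i j).le) (mem_univ j)).trans_eq (hstoch n i)
  have hσ := measurable_shiftBy N (n + 1)
  have hle : (ENNReal.ofReal δ * μ {x | ∀ k ≤ n, x k = w k}) • μ.map (shiftBy N (n + 1)) ≤
      (μ.restrict {x | ∀ k ≤ n, x k = w k}).map (shiftBy N (n + 1)) := by
    refine measure_le_of_word_le fun m v => ?_
    have hv := measurableSet_word m v
    rw [Measure.smul_apply, Measure.map_apply hσ hv, Measure.map_apply hσ hv,
      Measure.restrict_apply (hσ hv), Set.inter_comm, smul_eq_mul,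
      hμ.measure_word_inter_shiftBy hl hpos]
    have hfuture : μ (shiftBy N (n + 1) ⁻¹' {x | ∀ k ≤ m, x k = v k}) ≤
        ENNReal.ofReal (∏ k ∈ range m, T (n + 1 + k) (v k) (v (k + 1))) := by
      rw [sum_measure_inter_word μ n]
      simp only [hμ.measure_word_inter_shiftBy hl hpos]
      calc _ ≤ ∑ u : Fin (n + 1) → Fin N, μ ({x | ∀ k ≤ n, x k = extendWord u k} ∩ Set.univ) *
            ENNReal.ofReal (∏ k ∈ range m, T (n + 1 + k) (v k) (v (k + 1))) := by
            refine sum_le_sum fun u _ => ?_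
            rw [Set.inter_univ]
            gcongr
            exact mul_le_of_le_one_left' (ENNReal.ofReal_le_one.2 (hT _ _ _))
        _ = _ := by
            rw [← sum_mul, ← sum_measure_inter_word μ n, measure_univ, one_mul]
    calc _ ≤ ENNReal.ofReal (T n (w n) (v 0)) * μ {x | ∀ k ≤ n, x k = w k} *
          ENNReal.ofReal (∏ k ∈ range m, T (n + 1 + k) (v k) (v (k + 1))) := by
          gcongr
          exact hδ _ _ _
      _ = _ := by ring
  have := hle B
  rwa [Measure.smul_apply, Measure.map_apply hσ hB, Measure.map_apply hσ hB,
    Measure.restrict_apply (hσ hB), Set.inter_comm, smul_eq_mul] at this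

/-- A quasi-stationary Markov measure `μ` is ergodic with respect to the
one-sided shift `σ`: every Borel set `A` with `σ⁻¹(A) = A` satisfies `μ(A) = 0` or
`μ(Aᶜ) = 0`. -/
theorem markov_ergodic (N : ℕ) (hN : 2 ≤ N)
    (l : Fin N → ℝ) (T : ℕ → Matrix (Fin N) (Fin N) ℝ)
    (hl : ∀ i, 0 < l i) (hlsum : ∑ i, l i = 1)
    (hpos : ∀ n i j, 0 < T n i j) (hstoch : ∀ n i, ∑ j, T n i j = 1)
    (hfix : ∀ j, ∑ i, l i * T 0 i j = l j)
    (μ : Measure (ℕ → Fin N)) [IsProbabilityMeasure μ]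
    (hμ : IsMarkov μ l T)
    (hqs : ∀ x : ℕ → Fin N,
      Summable fun n => |T n (x n) (x (n + 1)) / T (n + 1) (x n) (x (n + 1)) - 1|) :
    ∀ A : Set (ℕ → Fin N), MeasurableSet A →
      (fun (x : ℕ → Fin N) (n : ℕ) => x (n + 1)) ⁻¹' A = A →
      μ A = 0 ∨ μ Aᶜ = 0 := by
  intro A hA hinv
  obtain ⟨δ, hδ0, hδ⟩ := exists_pos_le_of_quasiStationary hpos hqs
  have hle : (ENNReal.ofReal δ * μ A) • μ ≤ μ.restrict A := by
    refine measure_le_of_word_le fun n w => ?_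
    have := hμ.mul_measure_shiftBy_le hl hpos hstoch hδ n w hA
    rw [shiftBy_preimage hinv] at this
    rw [Measure.smul_apply, Measure.restrict_apply (measurableSet_word n w), smul_eq_mul]
    rwa [mul_right_comm] at this
  have h0 := hle Aᶜ
  rw [Measure.smul_apply, Measure.restrict_apply hA.compl, Set.compl_inter_self, measure_empty,
    smul_eq_mul, nonpos_iff_eq_zero, mul_eq_zero, mul_eq_zero] at h0
  rcases h0 with (h | h) | h
  · exact absurd h (ENNReal.ofReal_pos.2 hδ0).ne'
  · exact .inl h
  · exact .inr h
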